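/- Let 𝒞 be a triangulated category with a proper class ξ of triangles and enough ξ-projectives. Define 𝒢⁰𝒫(ξ) = 𝒫(ξ), 𝒢¹𝒫(ξ) = 𝒢𝒫(ξ), and inductively 𝒢ⁿ⁺¹𝒫(ξ) = 𝒢ⁿ(𝒢𝒫(ξ)) (objects admitting a complete resolution by objects of 𝒢ⁿ𝒫(ξ) via Hom(−,𝒢ⁿ𝒫(ξ))-exact triangles in ξ). Then 𝒢ⁿ𝒫(ξ) = 𝒢𝒫(ξ) for every n ≥ 1. -/

import Mathlib

open CategoryTheory CategoryTheory.Limits CategoryTheory.Pretriangulated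

namespace GorensteinTriangulated

variable {C : Type*} [Category C] [HasZeroObject C] [HasShift C ℤ] [Preadditive C]
  [∀ n : ℤ, (shiftFunctor C n).Additive] [Pretriangulated C]

/-- A triangle `A ⟶ B ⟶ C ⟶ ΣA` is split if it is isomorphic to the triangle
`A ⟶ A ⊞ C ⟶ C ⟶ ΣA` with structure maps `(1 0)`, `(0 1)ᵀ` and `0`. -/
def IsSplitTriangle (T : Triangle C) : Prop :=
  Nonempty (T ≅ Triangle.mk (biprod.inl : T.obj₁ ⟶ T.obj₁ ⊞ T.obj₃) biprod.snd
    (0 : T.obj₃ ⟶ T.obj₁⟦(1 : ℤ)⟧))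

/-- The triangle `T` becomes a short exact sequence after applying `Hom(Q, -)`. -/
def CoExact (T : Triangle C) (Q : C) : Prop :=
  Function.Injective (fun φ : Q ⟶ T.obj₁ => φ ≫ T.mor₁) ∧
  (∀ φ : Q ⟶ T.obj₂, φ ≫ T.mor₂ = 0 → ∃ ψ : Q ⟶ T.obj₁, φ = ψ ≫ T.mor₁) ∧
  Function.Surjective (fun φ : Q ⟶ T.obj₂ => φ ≫ T.mor₂)

/-- The triangle `T` becomes a short exact sequence after applying `Hom(-, Q)`. -/
def ContraExact (T : Triangle C) (Q : C) : Prop :=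
  Function.Injective (fun φ : T.obj₃ ⟶ Q => T.mor₂ ≫ φ) ∧
  (∀ φ : T.obj₂ ⟶ Q, T.mor₁ ≫ φ = 0 → ∃ ψ : T.obj₃ ⟶ Q, φ = T.mor₂ ≫ ψ) ∧
  Function.Surjective (fun φ : T.obj₂ ⟶ Q => T.mor₁ ≫ φ)

/-- Saturation of a class of triangles with respect to base change: in a base change
diagram, if the third vertical triangle and the second horizontal triangle are in `S`,
then the original triangle is in `S`. -/
def SaturatedBase (S : Set (Triangle C)) : Prop :=
  ∀ T ∈ (distinguishedTriangles : Set (Triangle C)),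
    ∀ (M G E : C) (α : M ⟶ G) (δ : M ⟶ E) (f' : T.obj₁ ⟶ G) (g' : G ⟶ E)
      (h' : E ⟶ T.obj₁⟦(1 : ℤ)⟧) (β : G ⟶ T.obj₂) (ε : E ⟶ T.obj₃)
      (γ : T.obj₂ ⟶ M⟦(1 : ℤ)⟧) (ζ : T.obj₃ ⟶ M⟦(1 : ℤ)⟧),
      Triangle.mk α β γ ∈ (distinguishedTriangles : Set (Triangle C)) →
      Triangle.mk f' g' h' ∈ S → Triangle.mk δ ε ζ ∈ S →
      α ≫ g' = δ → f' ≫ β = T.mor₁ → g' ≫ ε = β ≫ T.mor₂ → h' = ε ≫ T.mor₃ →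
      T.mor₂ ≫ ζ = γ → T ∈ S

/-- Saturation of a class of triangles with respect to cobase change: in a cobase change
diagram, if the second vertical triangle and the third horizontal triangle are in `S`,
then the original triangle is in `S`. -/
def SaturatedCobase (S : Set (Triangle C)) : Prop :=
  ∀ T ∈ (distinguishedTriangles : Set (Triangle C)),
    ∀ (N D F : C) (ζ : N ⟶ T.obj₁) (δ : N ⟶ T.obj₂) (α : T.obj₁ ⟶ D) (β : T.obj₂ ⟶ F)
      (f' : D ⟶ F) (g' : F ⟶ T.obj₃) (h' : T.obj₃ ⟶ D⟦(1 : ℤ)⟧)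
      (η : D ⟶ N⟦(1 : ℤ)⟧) (υ : F ⟶ N⟦(1 : ℤ)⟧),
      Triangle.mk ζ α η ∈ (distinguishedTriangles : Set (Triangle C)) →
      Triangle.mk δ β υ ∈ S → Triangle.mk f' g' h' ∈ S →
      ζ ≫ T.mor₁ = δ → T.mor₁ ≫ β = α ≫ f' → T.mor₂ = β ≫ g' →
      T.mor₃ ≫ (shiftFunctor C (1 : ℤ)).map α = h' → f' ≫ υ = η → T ∈ S

/-- A proper class of triangles in the sense of Beligiannis. -/
structure IsProperClass (S : Set (Triangle C)) : Prop where
  subset_dist : S ⊆ (distinguishedTriangles : Set (Triangle C))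
  split_mem : ∀ T : Triangle C, T ∈ (distinguishedTriangles : Set (Triangle C)) →
    IsSplitTriangle T → T ∈ S
  iso_closed : ∀ T₁ T₂ : Triangle C, Nonempty (T₁ ≅ T₂) → T₁ ∈ S → T₂ ∈ S
  sum_closed : ∀ T₁ ∈ S, ∀ T₂ ∈ S, ∀ T ∈ (distinguishedTriangles : Set (Triangle C)),
    Nonempty (T.obj₁ ≅ T₁.obj₁ ⊞ T₂.obj₁) →
    (∀ e₁ : T.obj₁ ≅ T₁.obj₁ ⊞ T₂.obj₁, ∀ e₂ : T.obj₂ ≅ T₁.obj₂ ⊞ T₂.obj₂,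
      ∀ e₃ : T.obj₃ ≅ T₁.obj₃ ⊞ T₂.obj₃,
      T.mor₁ = e₁.hom ≫ biprod.map T₁.mor₁ T₂.mor₁ ≫ e₂.inv →
      T.mor₂ = e₂.hom ≫ biprod.map T₁.mor₂ T₂.mor₂ ≫ e₃.inv →
      T.mor₃ = e₃.hom ≫ biprod.desc
        (T₁.mor₃ ≫ (shiftFunctor C (1 : ℤ)).map (biprod.inl ≫ e₁.inv))
        (T₂.mor₃ ≫ (shiftFunctor C (1 : ℤ)).map (biprod.inr ≫ e₁.inv)) → T ∈ S)
  susp_closed : ∀ T ∈ S, ∀ i : ℤ, (Triangle.shiftFunctor C i).obj T ∈ S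
  saturated : SaturatedBase S
  base_change : ∀ T ∈ S, ∀ {E : C} (ε : E ⟶ T.obj₃),
    ∃ (G : C) (f' : T.obj₁ ⟶ G) (g' : G ⟶ E) (h' : E ⟶ T.obj₁⟦(1 : ℤ)⟧) (β : G ⟶ T.obj₂),
      Triangle.mk f' g' h' ∈ S ∧ f' ≫ β = T.mor₁ ∧ g' ≫ ε = β ≫ T.mor₂ ∧ h' = ε ≫ T.mor₃
  cobase_change : ∀ T ∈ S, ∀ {D : C} (α : T.obj₁ ⟶ D),
    ∃ (F : C) (f' : D ⟶ F) (g' : F ⟶ T.obj₃) (h' : T.obj₃ ⟶ D⟦(1 : ℤ)⟧) (β : T.obj₂ ⟶ F),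
      Triangle.mk f' g' h' ∈ S ∧ T.mor₁ ≫ β = α ≫ f' ∧ T.mor₂ = β ≫ g' ∧
      T.mor₃ ≫ (shiftFunctor C (1 : ℤ)).map α = h'

/-- `P` is a `ξ`-projective object. -/
def XiProjective (S : Set (Triangle C)) (P : C) : Prop :=
  ∀ T ∈ S, CoExact T P

/-- `𝒞` has enough `ξ`-projectives. -/
def HasEnoughXiProjectives (S : Set (Triangle C)) : Prop :=
  ∀ A : C, ∃ (K P : C) (f : K ⟶ P) (g : P ⟶ A) (h : A ⟶ K⟦(1 : ℤ)⟧),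
    XiProjective S P ∧ Triangle.mk f g h ∈ S

/-- The objects admitting a complete resolution by triangles in `S` with middle terms in
`X` which are `Hom(-, Y)`-exact; `GClass S X X` is the Gorenstein category `𝒢(X)` and
`GClass S (XiProjective S) (XiProjective S)` is the class of `ξ`-Gorenstein projectives. -/
def GClass (S : Set (Triangle C)) (X Y : C → Prop) (A : C) : Prop :=
  ∃ (K P : ℤ → C) (f : ∀ n : ℤ, K (n + 1) ⟶ P n) (g : ∀ n : ℤ, P n ⟶ K n)
    (h : ∀ n : ℤ, K n ⟶ (K (n + 1))⟦(1 : ℤ)⟧),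
    K 0 = A ∧ ∀ n : ℤ, X (P n) ∧ Triangle.mk (f n) (g n) (h n) ∈ S ∧
      ∀ Q : C, Y Q → ContraExact (Triangle.mk (f n) (g n) (h n)) Q

/-- `ξ`-Gorenstein projective objects. -/
def GProjective (S : Set (Triangle C)) (A : C) : Prop :=
  GClass S (XiProjective S) (XiProjective S) A

/-- A `ξ`-exact resolution `⋯ → X₁ → X₀ → A → 0` with terms satisfying `X`, which is
`Hom(-, Q)`-exact for every `Q` satisfying `Y`. -/
def HasResolution (S : Set (Triangle C)) (X Y : C → Prop) (A : C) : Prop :=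
  ∃ (K G : ℕ → C) (f : ∀ n : ℕ, K (n + 1) ⟶ G n) (g : ∀ n : ℕ, G n ⟶ K n)
    (h : ∀ n : ℕ, K n ⟶ (K (n + 1))⟦(1 : ℤ)⟧),
    K 0 = A ∧ ∀ n : ℕ, X (G n) ∧ Triangle.mk (f n) (g n) (h n) ∈ S ∧
      ∀ Q : C, Y Q → ContraExact (Triangle.mk (f n) (g n) (h n)) Q

/-- A `ξ`-exact coresolution `0 → A → X⁰ → X¹ → ⋯` with terms satisfying `X`, which is
`Hom(-, Q)`-exact for every `Q` satisfying `Y`. -/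
def HasCoresolution (S : Set (Triangle C)) (X Y : C → Prop) (A : C) : Prop :=
  ∃ (K G : ℕ → C) (f : ∀ n : ℕ, K n ⟶ G n) (g : ∀ n : ℕ, G n ⟶ K (n + 1))
    (h : ∀ n : ℕ, K (n + 1) ⟶ (K n)⟦(1 : ℤ)⟧),
    K 0 = A ∧ ∀ n : ℕ, X (G n) ∧ Triangle.mk (f n) (g n) (h n) ∈ S ∧
      ∀ Q : C, Y Q → ContraExact (Triangle.mk (f n) (g n) (h n)) Q

/-- A finite `ξ`-exact sequence `0 → Gₙ → ⋯ → G₀ → A → 0` where the `j`-th term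
satisfies the predicate `X j`. -/
def FiniteRes (S : Set (Triangle C)) (n : ℕ) (X : ℕ → C → Prop) (A : C) : Prop :=
  ∃ (K G : ℕ → C) (f : ∀ j : ℕ, K (j + 1) ⟶ G j) (g : ∀ j : ℕ, G j ⟶ K j)
    (h : ∀ j : ℕ, K j ⟶ (K (j + 1))⟦(1 : ℤ)⟧),
    K 0 = A ∧ IsZero (K (n + 1)) ∧
    ∀ j ≤ n, X j (G j) ∧ Triangle.mk (f j) (g j) (h j) ∈ S

/-- `ξ`-Gorenstein projective dimension of `A` is at most `n`. -/
def GpdLE (S : Set (Triangle C)) (A : C) (n : ℕ) : Prop :=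
  FiniteRes S n (fun _ => GProjective S) A

set_option linter.unusedSectionVars false

/-- `A` admits a triangle `B ⟶ P ⟶ A ⟶ ΣB` in `S` with `P` in `X`
which is `Hom(-, Y)`-exact. -/
def Step (S : Set (Triangle C)) (X Y : C → Prop) (A B : C) : Prop :=
  ∃ (P : C) (f : B ⟶ P) (g : P ⟶ A) (h : A ⟶ B⟦(1 : ℤ)⟧),
    X P ∧ Triangle.mk f g h ∈ S ∧ ∀ Q : C, Y Q → ContraExact (Triangle.mk f g h) Q

lemma gClass_iff_step {S : Set (Triangle C)} {X Y : C → Prop} {A : C} :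
    GClass S X Y A ↔ ∃ K : ℤ → C, K 0 = A ∧ ∀ n, Step S X Y (K n) (K (n + 1)) := by
  constructor
  · rintro ⟨K, P, f, g, h, h0, H⟩
    exact ⟨K, h0, fun n => ⟨P n, f n, g n, h n, H n⟩⟩
  · rintro ⟨K, h0, H⟩
    choose P f g h H using H
    exact ⟨K, P, f, g, h, h0, H⟩

lemma GClass.exists_left {S : Set (Triangle C)} {X Y : C → Prop} {A : C}
    (hA : GClass S X Y A) : ∃ B, Step S X Y A B ∧ GClass S X Y B := by
  obtain ⟨K, rfl, H⟩ := gClass_iff_step.1 hA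
  exact ⟨K (0 + 1), H 0, gClass_iff_step.2 ⟨fun n => K (n + 1), rfl, fun n => H (n + 1)⟩⟩

lemma GClass.exists_right {S : Set (Triangle C)} {X Y : C → Prop} {A : C}
    (hA : GClass S X Y A) : ∃ B, Step S X Y B A ∧ GClass S X Y B := by
  obtain ⟨K, rfl, H⟩ := gClass_iff_step.1 hA
  refine ⟨K (-1), H (-1), gClass_iff_step.2 ⟨fun n => K (n - 1), rfl, fun n => ?_⟩⟩
  have h := H (n - 1)
  rw [show n - 1 + 1 = n + 1 - 1 by ring] at h
  exact h

lemma gClass_of_coinduction {S : Set (Triangle C)} {X Y : C → Prop} (R : C → Prop)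
    (hl : ∀ A, R A → ∃ B, Step S X Y A B ∧ R B)
    (hr : ∀ A, R A → ∃ B, Step S X Y B A ∧ R B) {A : C} (hA : R A) :
    GClass S X Y A := by
  choose! l hl hl' using hl
  choose! r hr hr' using hr
  have hL : ∀ n : ℕ, R (l^[n] A) := fun n => by
    induction n with
    | zero => exact hA
    | succ n ih => rw [Function.iterate_succ_apply']; exact hl' _ ih
  have hR : ∀ n : ℕ, R (r^[n] A) := fun n => by
    induction n with
    | zero => exact hA
    | succ n ih => rw [Function.iterate_succ_apply']; exact hr' _ ih
  let K : ℤ → C := fun n => match n with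
    | Int.ofNat m => l^[m] A
    | Int.negSucc m => r^[m + 1] A
  refine gClass_iff_step.2 ⟨K, rfl, fun n => ?_⟩
  rcases n with m | m
  · change Step S X Y (l^[m] A) (l^[m + 1] A)
    rw [Function.iterate_succ_apply']
    exact hl _ (hL m)
  · rcases m with _ | m
    · exact hr _ hA
    · have e : Int.negSucc (m + 1) + 1 = Int.negSucc m := by omega
      rw [e]
      change Step S X Y (r^[m + 1 + 1] A) (r^[m + 1] A)
      rw [Function.iterate_succ_apply']
      exact hr _ (hR (m + 1))

/-- A morphism annihilated by precomposition with all morphisms from `ξ`-projectives. -/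
def XiPhantom (S : Set (Triangle C)) {A B : C} (u : A ⟶ B) : Prop :=
  ∀ Q : C, XiProjective S Q → ∀ φ : Q ⟶ A, φ ≫ u = 0

/-- A morphism through which all morphisms from `ξ`-projectives lift. -/
def XiEpi (S : Set (Triangle C)) {A B : C} (g : A ⟶ B) : Prop :=
  ∀ Q : C, XiProjective S Q → ∀ φ : Q ⟶ B, ∃ ψ : Q ⟶ A, ψ ≫ g = φ

/-- A morphism which is left cancellable for morphisms from `ξ`-projectives. -/
def XiMono (S : Set (Triangle C)) {A B : C} (f : A ⟶ B) : Prop :=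
  ∀ Q : C, XiProjective S Q → ∀ φ : Q ⟶ A, φ ≫ f = 0 → φ = 0

/-- The only `ξ`-phantom morphisms from `A` to `ξ`-projectives are zero. -/
def PhantomFree (S : Set (Triangle C)) (A : C) : Prop :=
  ∀ Q : C, XiProjective S Q → ∀ u : A ⟶ Q, XiPhantom S u → u = 0

section

variable {S : Set (Triangle C)}

lemma XiPhantom.precomp {A B D : C} {u : A ⟶ B} (hu : XiPhantom S u) (v : D ⟶ A) :
    XiPhantom S (v ≫ u) := fun Q hQ _ => by
  rw [← Category.assoc]; exact hu Q hQ _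

lemma XiPhantom.postcomp {A B D : C} {u : A ⟶ B} (hu : XiPhantom S u) (v : B ⟶ D) :
    XiPhantom S (u ≫ v) := fun Q hQ φ => by
  rw [← Category.assoc, hu Q hQ, zero_comp]

lemma XiPhantom.eq_zero {A B : C} {u : A ⟶ B} (hu : XiPhantom S u) (hA : XiProjective S A) :
    u = 0 := by
  simpa using hu A hA (𝟙 A)

lemma XiPhantom.of_xiEpi {A B D : C} {g : A ⟶ B} {u : B ⟶ D} (hg : XiEpi S g)
    (hu : XiPhantom S (g ≫ u)) : XiPhantom S u := fun Q hQ φ => by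
  obtain ⟨ψ, rfl⟩ := hg Q hQ φ
  simpa using hu Q hQ ψ

lemma XiEpi.comp {A B D : C} {f : A ⟶ B} {g : B ⟶ D} (hf : XiEpi S f) (hg : XiEpi S g) :
    XiEpi S (f ≫ g) := fun Q hQ φ => by
  obtain ⟨ψ, rfl⟩ := hg Q hQ φ
  obtain ⟨χ, rfl⟩ := hf Q hQ ψ
  exact ⟨χ, by simp⟩

lemma XiMono.comp {A B D : C} {f : A ⟶ B} {g : B ⟶ D} (hf : XiMono S f) (hg : XiMono S g) :
    XiMono S (f ≫ g) := fun Q hQ φ h => by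
  exact hf Q hQ _ (hg Q hQ _ (by simpa using h))

lemma XiEpi.of_comp {A B D : C} {f : A ⟶ B} {g : B ⟶ D} (h : XiEpi S (f ≫ g)) :
    XiEpi S g := fun Q hQ φ => by
  obtain ⟨ψ, rfl⟩ := h Q hQ φ
  exact ⟨ψ ≫ f, by simp⟩

lemma XiMono.of_comp {A B D : C} {f : A ⟶ B} {g : B ⟶ D} (h : XiMono S (f ≫ g)) :
    XiMono S f := fun Q hQ φ hφ => h Q hQ φ (by rw [← Category.assoc, hφ, zero_comp])

variable {X₁ X₂ X₃ : C} {f : X₁ ⟶ X₂} {g : X₂ ⟶ X₃} {h : X₃ ⟶ X₁⟦(1 : ℤ)⟧}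

lemma xiEpi_of_mem (hT : Triangle.mk f g h ∈ S) : XiEpi S g :=
  fun _ hQ φ => (hQ _ hT).2.2 φ

lemma xiMono_of_mem (hT : Triangle.mk f g h ∈ S) : XiMono S f :=
  fun _ hQ _ hφ => (hQ _ hT).1 (hφ.trans zero_comp.symm)

lemma comp_eq_zero₂₃ (hT : Triangle.mk f g h ∈ distTriang C) : g ≫ h = 0 :=
  comp_distTriang_mor_zero₂₃ _ hT

lemma exists_factor₁ (hT : Triangle.mk f g h ∈ distTriang C) {Q : C} (φ : Q ⟶ X₂)
    (hφ : φ ≫ g = 0) : ∃ ψ : Q ⟶ X₁, φ = ψ ≫ f :=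
  Triangle.coyoneda_exact₂ _ hT φ hφ

lemma exists_factor₂ (hT : Triangle.mk f g h ∈ distTriang C) {Q : C} (φ : Q ⟶ X₃)
    (hφ : φ ≫ h = 0) : ∃ ψ : Q ⟶ X₂, φ = ψ ≫ g :=
  Triangle.coyoneda_exact₃ _ hT φ hφ

lemma exists_cofactor₃ (hT : Triangle.mk f g h ∈ distTriang C) {Q : C} (φ : X₂ ⟶ Q)
    (hφ : f ≫ φ = 0) : ∃ ψ : X₃ ⟶ Q, φ = g ≫ ψ :=
  Triangle.yoneda_exact₂ _ hT φ hφ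

lemma exists_hom₂ {A B D A' B' D' : C} {f : A ⟶ B} {g : B ⟶ D} {h : D ⟶ A⟦(1 : ℤ)⟧}
    {f' : A' ⟶ B'} {g' : B' ⟶ D'} {h' : D' ⟶ A'⟦(1 : ℤ)⟧}
    (hT : Triangle.mk f g h ∈ distTriang C) (hT' : Triangle.mk f' g' h' ∈ distTriang C)
    (a : A ⟶ A') (c : D ⟶ D') (comm : h ≫ a⟦(1 : ℤ)⟧' = c ≫ h') :
    ∃ b : B ⟶ B', f ≫ b = a ≫ f' ∧ g ≫ c = b ≫ g' :=
  complete_distinguished_triangle_morphism₂ _ _ hT hT' a c comm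

open ZeroObject in
lemma exists_cofactor₂ (hT : Triangle.mk f g h ∈ distTriang C) {Q : C} (φ : X₁ ⟶ Q)
    (hφ : h ≫ φ⟦(1 : ℤ)⟧' = 0) : ∃ ψ : X₂ ⟶ Q, f ≫ ψ = φ := by
  obtain ⟨ψ, hψ, -⟩ := exists_hom₂ hT (contractible_distinguished Q) φ 0
    (hφ.trans zero_comp.symm)
  exact ⟨ψ, hψ.trans (Category.comp_id _)⟩

lemma rot_mem (hT : Triangle.mk f g h ∈ distTriang C) :
    Triangle.mk g h (-f⟦(1 : ℤ)⟧') ∈ distTriang C :=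
  rot_of_distTriang _ hT

lemma xiPhantom_of_mem (hS : IsProperClass S) (hT : Triangle.mk f g h ∈ S) :
    XiPhantom S h := fun Q hQ φ => by
  obtain ⟨ψ, rfl⟩ := xiEpi_of_mem hT Q hQ φ
  rw [Category.assoc, comp_eq_zero₂₃ (hS.subset_dist hT), comp_zero]

lemma xiEpi_iff (hT : Triangle.mk f g h ∈ distTriang C) : XiEpi S g ↔ XiPhantom S h := by
  constructor
  · intro hg Q hQ φ
    obtain ⟨ψ, rfl⟩ := hg Q hQ φ
    rw [Category.assoc, comp_eq_zero₂₃ hT, comp_zero]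
  · intro hh Q hQ φ
    obtain ⟨ψ, hψ⟩ := exists_factor₂ hT φ (hh Q hQ φ)
    exact ⟨ψ, hψ.symm⟩

lemma xiProjective_of_phantom (hS : IsProperClass S) {P : C}
    (H : ∀ (Z : C) (u : P ⟶ Z), XiPhantom S u → u = 0) : XiProjective S P := by
  intro T hT
  refine ⟨fun φ₁ φ₂ hφ => ?_, fun φ hφ => exists_factor₁ (hS.subset_dist hT) φ hφ,
    fun φ => ?_⟩
  · rw [← sub_eq_zero]
    refine H _ _ fun Q hQ φ => xiMono_of_mem hT Q hQ _ ?_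
    have : φ₁ ≫ T.mor₁ = φ₂ ≫ T.mor₁ := hφ
    simp [this]
  · obtain ⟨ψ, hψ⟩ := exists_factor₂ (hS.subset_dist hT) φ
      (H _ _ ((xiPhantom_of_mem hS hT).precomp φ))
    exact ⟨ψ, hψ.symm⟩

lemma XiProjective.shift (hS : IsProperClass S) {Q : C} (hQ : XiProjective S Q) (n : ℤ) :
    XiProjective S (Q⟦n⟧) := by
  intro T hT
  let e : Q ≅ Q⟦n⟧⟦-n⟧ := (shiftShiftNeg Q n).symm
  obtain ⟨h₁, -, h₃⟩ := hQ _ (hS.susp_closed T hT (-n))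
  replace h₁ : ∀ φ₁ φ₂ : Q ⟶ T.obj₁⟦-n⟧, φ₁ ≫ ((-n).negOnePow • T.mor₁⟦-n⟧') =
    φ₂ ≫ ((-n).negOnePow • T.mor₁⟦-n⟧') → φ₁ = φ₂ := fun _ _ h => h₁ h
  replace h₃ : ∀ φ : Q ⟶ T.obj₃⟦-n⟧, ∃ ψ : Q ⟶ T.obj₂⟦-n⟧,
    ψ ≫ ((-n).negOnePow • T.mor₂⟦-n⟧') = φ := h₃
  refine ⟨fun φ₁ φ₂ hφ => ?_, fun φ hφ => exists_factor₁ (hS.subset_dist hT) φ hφ,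
    fun φ => ?_⟩
  · replace hφ : φ₁ ≫ T.mor₁ = φ₂ ≫ T.mor₁ := hφ
    apply (shiftFunctor C (-n)).map_injective
    rw [← cancel_epi e.hom]
    apply h₁
    simp only [Linear.comp_units_smul, Category.assoc, ← Functor.map_comp, hφ]
  · obtain ⟨ψ, hψ⟩ := h₃ (e.hom ≫ φ⟦-n⟧')
    obtain ⟨χ, hχ⟩ := (shiftFunctor C (-n)).map_surjective
      (e.inv ≫ ((-n).negOnePow • ψ))
    refine ⟨χ, (shiftFunctor C (-n)).map_injective ?_⟩
    change (χ ≫ T.mor₂)⟦-n⟧' = φ⟦-n⟧'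
    rw [Functor.map_comp, hχ, ← cancel_epi e.hom, ← hψ]
    simp only [Linear.comp_units_smul, Category.assoc, Linear.units_smul_comp,
      Iso.hom_inv_id_assoc]

lemma XiMono.shift (hS : IsProperClass S) {A B : C} {f : A ⟶ B} (hf : XiMono S f) :
    XiMono S (f⟦(1 : ℤ)⟧') := fun Q hQ φ hφ => by
  let e : Q⟦(-1 : ℤ)⟧⟦(1 : ℤ)⟧ ≅ Q := shiftNegShift Q 1
  obtain ⟨χ, hχ⟩ := (shiftFunctor C (1 : ℤ)).map_surjective (e.hom ≫ φ)
  have hχ0 : χ = 0 := hf _ (hQ.shift hS (-1)) χ ((shiftFunctor C (1 : ℤ)).map_injective (by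
    rw [Functor.map_comp, hχ, Category.assoc, hφ, comp_zero, Functor.map_zero]))
  rw [← cancel_epi e.hom, ← hχ, hχ0, comp_zero, Functor.map_zero]

lemma mem_of_mor₃_eq_zero (hS : IsProperClass S) (hT : Triangle.mk f g h ∈ distTriang C)
    (hh : h = 0) : Triangle.mk f g h ∈ S := by
  refine hS.split_mem _ hT ?_
  subst hh
  obtain ⟨e, he₁, he₂⟩ := exists_iso_binaryBiproduct_of_distTriang _ hT rfl
  exact ⟨Triangle.isoMk _ _ (Iso.refl _) e (Iso.refl _) (he₁.trans (Category.id_comp _).symm)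
    ((Category.comp_id _).trans he₂) (zero_comp.trans comp_zero.symm)⟩

lemma contraExact_of_mor₃_eq_zero (hT : Triangle.mk f g h ∈ distTriang C) (hh : h = 0)
    (Q : C) : ContraExact (Triangle.mk f g h) Q := by
  have : Epi g := Triangle.epi₂ _ hT hh
  refine ⟨fun φ₁ φ₂ hφ => ?_, fun φ hφ => exists_cofactor₃ hT φ hφ,
    fun φ => exists_cofactor₂ hT φ (by simp [hh])⟩
  exact (cancel_epi g).1 hφ

open ZeroObject in
lemma gClass_of_mem (hS : IsProperClass S) {X Y : C → Prop} {A : C} (hA : X A)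
    (h0 : X (0 : C)) : GClass S X Y A := by
  have hl : ∀ B, X B → Step S X Y B 0 := fun B hB =>
    ⟨B, 0, 𝟙 B, 0, hB, mem_of_mor₃_eq_zero hS (contractible_distinguished₁ B) rfl,
      fun Q _ => contraExact_of_mor₃_eq_zero (contractible_distinguished₁ B) rfl Q⟩
  have hr : ∀ B, X B → Step S X Y 0 B := fun B hB =>
    ⟨B, 𝟙 B, 0, 0, hB, mem_of_mor₃_eq_zero hS (contractible_distinguished B) rfl,
      fun Q _ => contraExact_of_mor₃_eq_zero (contractible_distinguished B) rfl Q⟩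
  exact gClass_of_coinduction (fun B => X B) (fun B hB => ⟨0, hl B hB, h0⟩)
    (fun B hB => ⟨0, hr B hB, h0⟩) hA

lemma xiProjective_of_isZero (hS : IsProperClass S) {A : C} (hA : IsZero A) :
    XiProjective S A :=
  xiProjective_of_phantom hS fun _ _ _ => hA.eq_of_src _ _

lemma GProjective.of_xiProjective (hS : IsProperClass S) {P : C} (hP : XiProjective S P) :
    GProjective S P :=
  gClass_of_mem hS hP (xiProjective_of_isZero hS (isZero_zero C))

variable [IsTriangulated C]

lemma exists_pullback {A B D K P : C} {f : A ⟶ B} {g : B ⟶ D} {δ : D ⟶ A⟦(1 : ℤ)⟧}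
    (h₁ : Triangle.mk f g δ ∈ distTriang C) {k : K ⟶ P} {e : P ⟶ D} {h : D ⟶ K⟦(1 : ℤ)⟧}
    (h₂ : Triangle.mk k e h ∈ distTriang C) :
    ∃ (Y : C) (a : A ⟶ Y) (p : Y ⟶ P) (α : K ⟶ Y) (β : Y ⟶ B),
      Triangle.mk a p (e ≫ δ) ∈ distTriang C ∧ Triangle.mk α β (g ≫ h) ∈ distTriang C ∧
      a ≫ β = f ∧ p ≫ e = β ≫ g ∧ α ≫ p = k := by
  obtain ⟨Y, α, β, hY⟩ := distinguished_cocone_triangle₂ (g ≫ h)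
  let o := Triangulated.someOctahedron' rfl h₁ (rot_mem h₂) (rot_mem hY)
  refine ⟨Y, o.m₁, o.m₃, α, β, o.mem, hY, o.comm₁, o.comm₄, ?_⟩
  apply (shiftFunctor C (1 : ℤ)).map_injective
  simpa using o.comm₃

lemma exists_pushout {A B D P L : C} {f : A ⟶ B} {g : B ⟶ D} {δ : D ⟶ A⟦(1 : ℤ)⟧}
    (h₁ : Triangle.mk f g δ ∈ distTriang C) {k : A ⟶ P} {c : P ⟶ L} {h : L ⟶ A⟦(1 : ℤ)⟧}
    (h₂ : Triangle.mk k c h ∈ distTriang C) :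
    ∃ (X : C) (p : P ⟶ X) (x : X ⟶ D) (z : D ⟶ P⟦(1 : ℤ)⟧) (a : B ⟶ X) (b : X ⟶ L)
      (w : L ⟶ B⟦(1 : ℤ)⟧),
      Triangle.mk p x z ∈ distTriang C ∧ Triangle.mk a b w ∈ distTriang C ∧
      a ≫ x = g ∧ p ≫ b = c := by
  obtain ⟨X, p, x, hX⟩ := distinguished_cocone_triangle₂ (δ ≫ (-k⟦(1 : ℤ)⟧'))
  let o := Triangulated.someOctahedron' rfl (rot_mem h₁) (rot_mem (rot_mem h₂)) (rot_mem hX)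
  refine ⟨X, p, x, _, o.m₁, o.m₃, _, hX, o.mem, o.comm₁, ?_⟩
  apply (shiftFunctor C (1 : ℤ)).map_injective
  simpa using o.comm₃

lemma mem_of_xiEpi (hS : IsProperClass S) (hE : HasEnoughXiProjectives S)
    (hT : Triangle.mk f g h ∈ distTriang C) (hg : XiEpi S g) : Triangle.mk f g h ∈ S := by
  obtain ⟨K, P, k, e, l, hP, hKP⟩ := hE X₃
  obtain ⟨Y, a, p, α, β, h₁, h₂, e₁, e₂, e₃⟩ := exists_pullback hT (hS.subset_dist hKP)
  exact hS.saturated _ hT K Y P α k a p (e ≫ h) β e (g ≫ l) l h₂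
    (mem_of_mor₃_eq_zero hS h₁ ((xiEpi_iff hT).1 hg _ hP e)) hKP e₃ e₁ e₂ rfl rfl

lemma mem_of_xiMono (hS : IsProperClass S) (hE : HasEnoughXiProjectives S)
    (hT : Triangle.mk f g h ∈ distTriang C) (hf : XiMono S f) : Triangle.mk f g h ∈ S := by
  refine mem_of_xiEpi hS hE hT ((xiEpi_iff hT).2 fun Q hQ φ => ?_)
  refine hf.shift hS Q hQ _ ?_
  have : h ≫ f⟦(1 : ℤ)⟧' = 0 := comp_distTriang_mor_zero₃₁ _ hT
  rw [Category.assoc, this, comp_zero]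

lemma exists_comp_left (hS : IsProperClass S) (hE : HasEnoughXiProjectives S)
    {K P Y K' B : C} {i : K ⟶ P} {j : P ⟶ Y} {w : Y ⟶ K⟦(1 : ℤ)⟧}
    (h₁ : Triangle.mk i j w ∈ S) {k : K' ⟶ Y} {e : Y ⟶ B} {w' : B ⟶ K'⟦(1 : ℤ)⟧}
    (h₂ : Triangle.mk k e w' ∈ S) :
    ∃ (L : C) (a : K ⟶ L) (b : L ⟶ K') (c : K' ⟶ K⟦(1 : ℤ)⟧) (l : L ⟶ P) (q : P ⟶ B)
      (d : B ⟶ L⟦(1 : ℤ)⟧), Triangle.mk a b c ∈ S ∧ Triangle.mk l q d ∈ S := by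
  obtain ⟨L, l, d, hL⟩ := distinguished_cocone_triangle₁ (j ≫ e)
  let o := Triangulated.someOctahedron' rfl (hS.subset_dist h₁) (hS.subset_dist h₂) hL
  refine ⟨L, o.m₁, o.m₃, _, l, j ≫ e, d, mem_of_xiMono hS hE o.mem ?_,
    mem_of_xiEpi hS hE hL ((xiEpi_of_mem h₁).comp (xiEpi_of_mem h₂))⟩
  refine XiMono.of_comp (g := l) ?_
  rw [o.comm₁]
  exact xiMono_of_mem h₁

lemma exists_comp_right (hS : IsProperClass S) (hE : HasEnoughXiProjectives S)
    {B X L P L' : C} {i : B ⟶ X} {j : X ⟶ L} {w : L ⟶ B⟦(1 : ℤ)⟧}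
    (h₁ : Triangle.mk i j w ∈ S) {k : X ⟶ P} {e : P ⟶ L'} {w' : L' ⟶ X⟦(1 : ℤ)⟧}
    (h₂ : Triangle.mk k e w' ∈ S) :
    ∃ (M : C) (a : L ⟶ M) (b : M ⟶ L') (c : L' ⟶ L⟦(1 : ℤ)⟧) (l : B ⟶ P) (q : P ⟶ M)
      (d : M ⟶ B⟦(1 : ℤ)⟧), Triangle.mk a b c ∈ S ∧ Triangle.mk l q d ∈ S := by
  obtain ⟨M, q, d, hM⟩ := distinguished_cocone_triangle (i ≫ k)
  let o := Triangulated.someOctahedron rfl (hS.subset_dist h₁) (hS.subset_dist h₂) hM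
  refine ⟨M, o.m₁, o.m₃, _, i ≫ k, q, d, mem_of_xiEpi hS hE o.mem ?_,
    mem_of_xiMono hS hE hM ((xiMono_of_mem h₁).comp (xiMono_of_mem h₂))⟩
  refine XiEpi.of_comp (f := q) ?_
  rw [o.comm₃]
  exact xiEpi_of_mem h₂

lemma exists_split_left (hS : IsProperClass S) (hE : HasEnoughXiProjectives S)
    {A Y P' K P : C} {a : A ⟶ Y} {p : Y ⟶ P'} {z : P' ⟶ A⟦(1 : ℤ)⟧}
    (h₁ : Triangle.mk a p z ∈ S) {k : K ⟶ P} {e : P ⟶ A} {h : A ⟶ K⟦(1 : ℤ)⟧}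
    (h₂ : Triangle.mk k e h ∈ S) (hP : XiProjective S P) (hP' : XiProjective S P') :
    ∃ (P'' : C) (i : K ⟶ P'') (j : P'' ⟶ Y) (w : Y ⟶ K⟦(1 : ℤ)⟧),
      XiProjective S P'' ∧ Triangle.mk i j w ∈ S := by
  have hz : z = 0 := (xiPhantom_of_mem hS h₁).eq_zero hP'
  obtain ⟨ε, hε₁, hε₂⟩ : ∃ ε : Y ≅ A ⊞ P', a ≫ ε.hom = biprod.inl ∧
      p = ε.hom ≫ biprod.snd :=
    exists_iso_binaryBiproduct_of_distTriang _ (hS.subset_dist h₁) hz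
  let r : Y ⟶ A := ε.hom ≫ biprod.fst
  let s : P' ⟶ Y := biprod.inr ≫ ε.inv
  have har : a ≫ r = 𝟙 A := by simp [r, reassoc_of% hε₁]
  have hsr : s ≫ r = 0 := by simp [r, s]
  have ha : a = biprod.inl ≫ ε.inv := by rw [← hε₁]; simp
  have hid : r ≫ a + p ≫ s = 𝟙 Y := by
    have : ε.hom ≫ (biprod.fst ≫ biprod.inl + biprod.snd ≫ biprod.inr) ≫ ε.inv = 𝟙 Y := by
      rw [biprod.total, Category.id_comp, ε.hom_inv_id]
    simpa only [r, s, ha, hε₂, Preadditive.add_comp, Preadditive.comp_add,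
      Category.assoc] using this
  obtain ⟨P'', i, j, hT⟩ := distinguished_cocone_triangle₂ (r ≫ h)
  obtain ⟨t, ht₁, ht₂⟩ := exists_hom₂ (hS.subset_dist h₂) hT
    (𝟙 K) a (by simp [reassoc_of% har])
  obtain ⟨q, hq₁, hq₂⟩ := exists_hom₂ hT (hS.subset_dist h₂)
    (𝟙 K) r (by simp)
  rw [Category.id_comp] at ht₁ hq₁
  refine ⟨P'', i, j, _, xiProjective_of_phantom hS fun Z u hu => ?_,
    mem_of_xiEpi hS hE hT ((xiEpi_iff hT).2 ((xiPhantom_of_mem hS h₂).precomp r))⟩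
  have htu : t ≫ u = 0 := hu P hP t
  obtain ⟨v, rfl⟩ := exists_cofactor₃ hT u (by rw [← ht₁, Category.assoc, htu, comp_zero])
  obtain ⟨s', hs'⟩ := exists_factor₂ hT s (by rw [reassoc_of% hsr, zero_comp])
  have hsv : s ≫ v = 0 := by rw [hs', Category.assoc]; exact hu P' hP' s'
  have heav : e ≫ a ≫ v = 0 := by rw [reassoc_of% ht₂, htu]
  have hv : v = r ≫ a ≫ v := by
    have := hid =≫ v
    simpa [hsv] using this.symm
  rw [hv, reassoc_of% hq₂, heav, comp_zero]

lemma exists_split_right (hS : IsProperClass S) (hE : HasEnoughXiProjectives S)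
    {P X D P' L' : C} {a : P ⟶ X} {p : X ⟶ D} {z : D ⟶ P⟦(1 : ℤ)⟧}
    (h₁ : Triangle.mk a p z ∈ S) {c : D ⟶ P'} {c' : P' ⟶ L'} {h : L' ⟶ D⟦(1 : ℤ)⟧}
    (h₂ : Triangle.mk c c' h ∈ S) (hP : XiProjective S P) (hP' : XiProjective S P')
    (hD : PhantomFree S D) :
    ∃ (P'' : C) (i : X ⟶ P'') (j : P'' ⟶ L') (w : L' ⟶ X⟦(1 : ℤ)⟧),
      XiProjective S P'' ∧ Triangle.mk i j w ∈ S := by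
  have hz : z = 0 := hD _ (hP.shift hS 1) z (xiPhantom_of_mem hS h₁)
  obtain ⟨s, hs⟩ := exists_factor₂ (hS.subset_dist h₁) (𝟙 D) (by simp [hz])
  obtain ⟨P'', i, j, hT⟩ := distinguished_cocone_triangle₂ (h ≫ s⟦(1 : ℤ)⟧')
  obtain ⟨t, ht₁, ht₂⟩ := exists_hom₂ (hS.subset_dist h₂) hT
    s (𝟙 L') (Category.id_comp _).symm
  obtain ⟨q, hq₁, hq₂⟩ := exists_hom₂ hT (hS.subset_dist h₂)
    p (𝟙 L') (by
      rw [Category.assoc, ← Functor.map_comp, ← hs, CategoryTheory.Functor.map_id, Category.comp_id,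
        Category.id_comp])
  rw [Category.comp_id] at ht₂ hq₂
  refine ⟨P'', i, j, _, xiProjective_of_phantom hS fun Z u hu => ?_,
    mem_of_xiEpi hS hE hT ((xiEpi_iff hT).2 ((xiPhantom_of_mem hS h₂).postcomp _))⟩
  have htu : t ≫ u = 0 := hu P' hP' t
  have hiu : i ≫ u = 0 := by
    obtain ⟨y, hy⟩ := exists_cofactor₃ (hS.subset_dist h₁) (i ≫ u)
      (by rw [← Category.assoc]; exact hu P hP _)
    have hy0 : y = 0 := by
      rw [← Category.id_comp y, hs, Category.assoc, ← hy, ← reassoc_of% ht₁, htu, comp_zero]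
    rw [hy, hy0, comp_zero]
  obtain ⟨v, rfl⟩ := exists_cofactor₃ hT u hiu
  have hcv : c' ≫ v = 0 := by rw [ht₂, Category.assoc, htu]
  rw [hq₂, Category.assoc, hcv, comp_zero]

lemma PhantomFree.contraExact (hS : IsProperClass S) (hT : Triangle.mk f g h ∈ S)
    (hX : PhantomFree S X₃) {Q : C} (hQ : XiProjective S Q) :
    ContraExact (Triangle.mk f g h) Q := by
  refine ⟨fun (φ₁ φ₂ : X₃ ⟶ Q) hφ => ?_,
    fun φ hφ => exists_cofactor₃ (hS.subset_dist hT) φ hφ,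
    fun φ => exists_cofactor₂ (hS.subset_dist hT) φ
      (hX _ (hQ.shift hS 1) _ ((xiPhantom_of_mem hS hT).postcomp _))⟩
  refine sub_eq_zero.1 (hX Q hQ (φ₁ - φ₂) (XiPhantom.of_xiEpi (xiEpi_of_mem hT) ?_))
  replace hφ : g ≫ φ₁ = g ≫ φ₂ := hφ
  rw [Preadditive.comp_sub, hφ, sub_self]
  exact fun _ _ _ => comp_zero

lemma PhantomFree.of_contraExact (hX : PhantomFree S X₂)
    (H : ∀ Q, XiProjective S Q → ContraExact (Triangle.mk f g h) Q) : PhantomFree S X₃ :=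
  fun Q hQ _ hu => (H Q hQ).1 ((hX Q hQ _ (hu.precomp g)).trans comp_zero.symm)

lemma PhantomFree.extension (hS : IsProperClass S) (hT : Triangle.mk f g h ∈ S)
    (h₁ : PhantomFree S X₁) (h₃ : PhantomFree S X₃) : PhantomFree S X₂ := by
  intro Q hQ u hu
  obtain ⟨v, rfl⟩ := exists_cofactor₃ (hS.subset_dist hT) u (h₁ Q hQ _ (hu.precomp f))
  rw [h₃ Q hQ v (XiPhantom.of_xiEpi (xiEpi_of_mem hT) hu), comp_zero]

lemma PhantomFree.of_gProjective {A : C} (hA : GProjective S A) : PhantomFree S A := by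
  obtain ⟨B, ⟨P, f, g, h, hP, -, H⟩, -⟩ := hA.exists_left
  exact PhantomFree.of_contraExact (fun _ _ _ hu => hu.eq_zero hP) H

/-- The closure under extensions in `S` of the objects having a complete resolution by
`ξ`-Gorenstein projective objects, together with the latter. -/
inductive GExtension (S : Set (Triangle C)) : C → Prop
  | gProjective {A : C} : GProjective S A → GExtension S A
  | gClass {A : C} : GClass S (GProjective S) (GProjective S) A → GExtension S A
  | extension {A B D : C} {f : A ⟶ B} {g : B ⟶ D} {h : D ⟶ A⟦(1 : ℤ)⟧} :
      Triangle.mk f g h ∈ S → GExtension S A → GExtension S D → GExtension S B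

lemma GExtension.phantomFree (hS : IsProperClass S) {A : C} (hA : GExtension S A) :
    PhantomFree S A := by
  induction hA with
  | gProjective hA => exact PhantomFree.of_gProjective hA
  | gClass hA =>
    obtain ⟨B, ⟨P, f, g, h, hP, -, H⟩, -⟩ := hA.exists_left
    exact (PhantomFree.of_gProjective hP).of_contraExact
      fun Q hQ => H Q (GProjective.of_xiProjective hS hQ)
  | extension hT _ _ h₁ h₃ => exact PhantomFree.extension hS hT h₁ h₃

lemma GExtension.exists_left (hS : IsProperClass S) (hE : HasEnoughXiProjectives S) {A : C}
    (hA : GExtension S A) : ∃ (K P : C) (f : K ⟶ P) (g : P ⟶ A) (h : A ⟶ K⟦(1 : ℤ)⟧),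
      XiProjective S P ∧ Triangle.mk f g h ∈ S ∧ GExtension S K := by
  induction hA with
  | gProjective hA =>
    obtain ⟨K, ⟨P, f, g, h, hP, hT, -⟩, hK⟩ := hA.exists_left
    exact ⟨K, P, f, g, h, hP, hT, .gProjective hK⟩
  | gClass hA =>
    obtain ⟨B, ⟨G, f, g, h, hG, hT, -⟩, hB⟩ := hA.exists_left
    obtain ⟨K, ⟨P, f', g', h', hP, hT', -⟩, hK⟩ := GClass.exists_left hG
    obtain ⟨L, a, b, c, l, q, d, h₁, h₂⟩ := exists_comp_left hS hE hT' hT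
    exact ⟨L, P, l, q, d, hP, h₂, .extension h₁ (.gProjective hK) (.gClass hB)⟩
  | extension hT _ _ ih₁ ih₃ =>
    obtain ⟨K, P, k, e, h, hP, hT₁, hK⟩ := ih₁
    obtain ⟨K', P', k', e', h', hP', hT₃, hK'⟩ := ih₃
    obtain ⟨Y, a, p, α, β, h₁, h₂, e₁, e₂, e₃⟩ :=
      exists_pullback (hS.subset_dist hT) (hS.subset_dist hT₃)
    replace h₁ := mem_of_xiMono hS hE h₁
      (XiMono.of_comp (g := β) (by rw [e₁]; exact xiMono_of_mem hT))
    replace h₂ := mem_of_xiMono hS hE h₂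
      (XiMono.of_comp (g := p) (by rw [e₃]; exact xiMono_of_mem hT₃))
    obtain ⟨P'', i, j, w, hP'', hT''⟩ := exists_split_left hS hE h₁ hT₁ hP hP'
    obtain ⟨L, a, b, c, l, q, d, h₃, h₄⟩ := exists_comp_left hS hE hT'' h₂
    exact ⟨L, P'', l, q, d, hP'', h₄, .extension h₃ hK hK'⟩

lemma GExtension.exists_right (hS : IsProperClass S) (hE : HasEnoughXiProjectives S) {A : C}
    (hA : GExtension S A) : ∃ (L P : C) (f : A ⟶ P) (g : P ⟶ L) (h : L ⟶ A⟦(1 : ℤ)⟧),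
      XiProjective S P ∧ Triangle.mk f g h ∈ S ∧ GExtension S L := by
  induction hA with
  | gProjective hA =>
    obtain ⟨L, ⟨P, f, g, h, hP, hT, -⟩, hL⟩ := hA.exists_right
    exact ⟨L, P, f, g, h, hP, hT, .gProjective hL⟩
  | gClass hA =>
    obtain ⟨B, ⟨G, f, g, h, hG, hT, -⟩, hB⟩ := hA.exists_right
    obtain ⟨L, ⟨P, f', g', h', hP, hT', -⟩, hL⟩ := GClass.exists_right hG
    obtain ⟨M, a, b, c, l, q, d, h₁, h₂⟩ := exists_comp_right hS hE hT hT'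
    exact ⟨M, P, l, q, d, hP, h₂, .extension h₁ (.gClass hB) (.gProjective hL)⟩
  | extension hT _ hD ih₁ ih₃ =>
    obtain ⟨L, P, k, c, h, hP, hT₁, hL⟩ := ih₁
    obtain ⟨L', P', k', c', h', hP', hT₃, hL'⟩ := ih₃
    obtain ⟨X, p, x, z, a, b, w, h₁, h₂, e₁, e₂⟩ :=
      exists_pushout (hS.subset_dist hT) (hS.subset_dist hT₁)
    replace h₁ := mem_of_xiEpi hS hE h₁
      (XiEpi.of_comp (f := a) (by rw [e₁]; exact xiEpi_of_mem hT))
    replace h₂ := mem_of_xiEpi hS hE h₂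
      (XiEpi.of_comp (f := p) (by rw [e₂]; exact xiEpi_of_mem hT₁))
    obtain ⟨P'', i, j, w, hP'', hT''⟩ :=
      exists_split_right hS hE h₁ hT₃ hP hP' (hD.phantomFree hS)
    obtain ⟨M, a, b, c, l, q, d, h₃, h₄⟩ := exists_comp_right hS hE h₂ hT''
    exact ⟨M, P'', l, q, d, hP'', h₄, .extension h₃ hL hL'⟩

lemma GExtension.isGProjective (hS : IsProperClass S) (hE : HasEnoughXiProjectives S) {A : C}
    (hA : GExtension S A) : GProjective S A := by
  refine gClass_of_coinduction (GExtension S) (fun A hA => ?_) (fun A hA => ?_) hA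
  · obtain ⟨K, P, f, g, h, hP, hT, hK⟩ := hA.exists_left hS hE
    exact ⟨K, ⟨P, f, g, h, hP, hT, fun Q hQ => (hA.phantomFree hS).contraExact hS hT hQ⟩, hK⟩
  · obtain ⟨L, P, f, g, h, hP, hT, hL⟩ := hA.exists_right hS hE
    exact ⟨L, ⟨P, f, g, h, hP, hT, fun Q hQ => (hL.phantomFree hS).contraExact hS hT hQ⟩, hL⟩

lemma gClass_gProjective (hS : IsProperClass S) (hE : HasEnoughXiProjectives S) :
    GClass S (GProjective S) (GProjective S) = GProjective S := by
  ext A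
  exact ⟨fun hA => (GExtension.gClass hA).isGProjective hS hE, fun hA => gClass_of_mem hS hA
    (GProjective.of_xiProjective hS (xiProjective_of_isZero hS (isZero_zero C)))⟩

end

variable [IsTriangulated C]

theorem gclass_iterate_eq_gProjective (S : Set (Triangle C))
    (hS : IsProperClass S) (hE : HasEnoughXiProjectives S) (n : ℕ) (hn : 1 ≤ n) :
    (fun X : C → Prop => GClass S X X)^[n] (XiProjective S) =
      GClass S (XiProjective S) (XiProjective S) := by
  obtain ⟨m, rfl⟩ := Nat.exists_eq_add_of_le' hn
  clear hn
  induction m with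
  | zero => rfl
  | succ m ih =>
    rw [Function.iterate_succ_apply', ih]
    exact gClass_gProjective hS hE

end GorensteinTriangulated
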